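/- For every integer k ≥ 0, the ℂ-linear map M_k(Γ₁(7);ℂ) → ℂ^{2k+1} sending a modular form f to the first 2k+1 Taylor coefficients at 0 of the holomorphic function g on the open unit disc determined by f(τ) = g(e^{2πiτ}) is an isomorphism of ℂ-vector spaces. In particular, a holomorphic modular form of weight k for Γ₁(7) whose q-expansion vanishes modulo q^{2k+1} is zero, and dim_ℂ M_k(Γ₁(7);ℂ) = 2k+1. -/

import Mathlib

open UpperHalfPlane

section PartA

open UpperHalfPlane CongruenceSubgroup Filter Topology Asymptotics
open scoped MatrixGroups ModularForm

namespace Gam7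

lemma le_order_of_isBigO {F : ℂ → ℂ} (hF : AnalyticAt ℂ F 0) {n : ℕ}
    (h : F =O[𝓝[≠] (0:ℂ)] fun q ↦ q ^ n) : (n : ℕ∞) ≤ analyticOrderAt F 0 := by
  by_contra! hlt
  obtain ⟨m, hm⟩ := ENat.ne_top_iff_exists.mp (ne_top_of_lt hlt)
  rw [← hm] at hlt
  have hmn : m < n := by exact_mod_cast hlt
  obtain ⟨g, hg, hg0, hFg⟩ := (hF.analyticOrderAt_eq_natCast).mp hm.symm
  have h1 : (fun q : ℂ ↦ q ^ m * g q) =O[𝓝[≠] (0:ℂ)] fun q ↦ q ^ m * q ^ (n - m) := by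
    refine (h.congr' ?_ ?_)
    · filter_upwards [hFg.filter_mono nhdsWithin_le_nhds] with q hq
      simpa using hq
    · filter_upwards with q
      rw [← pow_add]; congr 1; omega
  have h2 : g =O[𝓝[≠] (0:ℂ)] fun q ↦ q ^ (n - m) := by
    obtain ⟨C, hC⟩ := h1.bound
    refine IsBigO.of_bound C ?_
    filter_upwards [hC, self_mem_nhdsWithin] with q hq hq0
    rw [norm_mul, norm_mul, mul_left_comm] at hq
    exact le_of_mul_le_mul_left hq (norm_pos_iff.mpr (pow_ne_zero _ hq0))
  have h3 : Tendsto (fun q : ℂ ↦ q ^ (n - m)) (𝓝[≠] (0:ℂ)) (𝓝 0) := by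
    have : Tendsto (fun q : ℂ ↦ q ^ (n - m)) (𝓝 (0:ℂ)) (𝓝 (0 ^ (n-m))) :=
      (continuous_pow (n - m)).tendsto 0
    rw [zero_pow (by omega)] at this
    exact this.mono_left nhdsWithin_le_nhds
  have h4 := h2.trans_tendsto h3
  have h5 : Tendsto g (𝓝[≠] (0:ℂ)) (𝓝 (g 0)) := hg.continuousAt.tendsto.mono_left nhdsWithin_le_nhds
  exact hg0 (tendsto_nhds_unique h5 h4)

lemma isBigO_of_le_order {F : ℂ → ℂ} (hF : AnalyticAt ℂ F 0) {n : ℕ}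
    (h : (n : ℕ∞) ≤ analyticOrderAt F 0) : F =O[𝓝 (0:ℂ)] fun q ↦ q ^ n := by
  obtain ⟨g, hg, hFg⟩ := (natCast_le_analyticOrderAt hF).mp h
  have : (fun q : ℂ ↦ q ^ n * g q) =O[𝓝 (0:ℂ)] fun q ↦ q ^ n * (1:ℂ) :=
    (isBigO_refl _ _).mul (hg.continuousAt.tendsto.isBigO_one ℂ)
  refine this.congr' ?_ ?_
  · filter_upwards [hFg] with q hq
    simpa using hq.symm
  · filter_upwards with q; simp

variable {Γ : Subgroup (GL (Fin 2) ℝ)} {k : ℤ}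

/-- Coefficients below `n` vanish iff the order at zero of the cusp function is at least `n`. -/
lemma order_iff (hΓ : (1:ℝ) ∈ Γ.strictPeriods) (f : ModularForm Γ k) (n : ℕ) :
    (n : ℕ∞) ≤ analyticOrderAt (cuspFunction 1 f) 0 ↔ ∀ i < n, (qExpansion 1 f).coeff i = 0 := by
  rw [natCast_le_analyticOrderAt_iff_iteratedDeriv_eq_zero
    (ModularFormClass.analyticAt_cuspFunction_zero f one_pos hΓ)]
  simp [qExpansion_coeff, Nat.factorial_ne_zero]

lemma coeff_eq_zero_of_isBigO (hΓ : (1:ℝ) ∈ Γ.strictPeriods) (f : ModularForm Γ k) (n : ℕ)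
    (h : f =O[atImInfty] fun τ : ℍ ↦ (Function.Periodic.qParam 1 τ) ^ n) :
    ∀ i < n, (qExpansion 1 f).coeff i = 0 := by
  rw [← order_iff hΓ]
  apply le_order_of_isBigO (ModularFormClass.analyticAt_cuspFunction_zero f one_pos hΓ)
  have := (h.comp_tendsto tendsto_comap_im_ofComplex).comp_tendsto
    (Function.Periodic.invQParam_tendsto (h := 1) one_pos)
  refine this.congr' ?_ ?_
  · filter_upwards [self_mem_nhdsWithin, nhdsWithin_le_nhds (Metric.ball_mem_nhds (0:ℂ) one_pos)]
      with q hq hq1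
    have him := Function.Periodic.im_invQParam_pos_of_norm_lt_one one_pos (by simpa using hq1) hq
    have := SlashInvariantFormClass.eq_cuspFunction f (ofComplex (Function.Periodic.invQParam 1 q))
      hΓ one_ne_zero
    rw [ofComplex_apply_of_im_pos him] at this
    simp only [Function.comp]
    rw [ofComplex_apply_of_im_pos him, ← this]
    simp [Function.Periodic.qParam_right_inv one_ne_zero hq]
  · filter_upwards [self_mem_nhdsWithin, nhdsWithin_le_nhds (Metric.ball_mem_nhds (0:ℂ) one_pos)]
      with q hq hq1
    have him := Function.Periodic.im_invQParam_pos_of_norm_lt_one one_pos (by simpa using hq1) hq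
    simp only [Function.comp]
    rw [ofComplex_apply_of_im_pos him]
    simp [Function.Periodic.qParam_right_inv one_ne_zero hq]

lemma isBigO_of_coeff_eq_zero (hΓ : (1:ℝ) ∈ Γ.strictPeriods) (f : ModularForm Γ k) (n : ℕ)
    (h : ∀ i < n, (qExpansion 1 f).coeff i = 0) :
    f =O[atImInfty] fun τ : ℍ ↦ (Function.Periodic.qParam 1 τ) ^ n := by
  rw [← order_iff hΓ] at h
  have := (isBigO_of_le_order
    (ModularFormClass.analyticAt_cuspFunction_zero f one_pos hΓ) h).comp_tendsto
    ((qParam_tendsto_atImInfty (h := 1) one_pos))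
  refine this.congr_left fun τ ↦ ?_
  simpa using SlashInvariantFormClass.eq_cuspFunction f τ hΓ one_ne_zero

end Gam7

end PartA

section PartB

open UpperHalfPlane CongruenceSubgroup Filter Topology Asymptotics
open scoped MatrixGroups ModularForm

namespace Gam7

/-- The image of `Γ₁(7)` in `GL(2, ℝ)`. -/
abbrev G7 : Subgroup (GL (Fin 2) ℝ) := Subgroup.map (Matrix.SpecialLinearGroup.mapGL ℝ) (Gamma1 7)

lemma one_mem_periods : (1 : ℝ) ∈ G7.strictPeriods := by simp

lemma mem_G7_iff (γ : SL(2, ℤ)) :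
    (Matrix.SpecialLinearGroup.mapGL ℝ γ) ∈ G7 ↔ γ ∈ Gamma1 7 := by
  constructor
  · rintro ⟨δ, hδ, h⟩
    rwa [Matrix.SpecialLinearGroup.mapGL_injective h] at hδ
  · intro h; exact ⟨γ, h, rfl⟩

abbrev Q7 := 𝒮ℒ ⧸ (G7.subgroupOf 𝒮ℒ)

/-- first column modulo 7 -/
def col (γ : SL(2, ℤ)) : ZMod 7 × ZMod 7 := ((γ 0 0 : ℤ), (γ 1 0 : ℤ))

lemma col_ne (γ : SL(2, ℤ)) : col γ ≠ 0 := by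
  intro h
  have h1 : ((γ 0 0 : ℤ) : ZMod 7) = 0 := congrArg Prod.fst h
  have h2 : ((γ 1 0 : ℤ) : ZMod 7) = 0 := congrArg Prod.snd h
  have hd := γ.det_coe
  rw [Matrix.det_fin_two] at hd
  have := congrArg (Int.cast : ℤ → ZMod 7) hd
  push_cast at this
  rw [h1, h2] at this
  simp only [zero_mul, mul_zero, sub_zero] at this
  exact absurd this (by decide)

lemma mem_of_col_eq (γ δ : SL(2, ℤ)) (h : col γ = col δ) : γ⁻¹ * δ ∈ Gamma1 7 := by
  have h1 : ((γ 0 0 : ℤ) : ZMod 7) = (δ 0 0 : ℤ) := congrArg Prod.fst h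
  have h2 : ((γ 1 0 : ℤ) : ZMod 7) = (δ 1 0 : ℤ) := congrArg Prod.snd h
  have hd := γ.det_coe
  have hd' := δ.det_coe
  rw [Matrix.det_fin_two] at hd hd'
  have e1 := congrArg (Int.cast : ℤ → ZMod 7) hd
  have e2 := congrArg (Int.cast : ℤ → ZMod 7) hd'
  push_cast at e1 e2
  rw [Gamma1_mem]
  have hm : ((γ⁻¹ * δ : SL(2, ℤ)) : Matrix (Fin 2) (Fin 2) ℤ) =
      (γ : Matrix (Fin 2) (Fin 2) ℤ).adjugate * (δ : Matrix (Fin 2) (Fin 2) ℤ) := rfl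
  rw [hm, Matrix.adjugate_fin_two]
  simp only [Matrix.mul_apply, Fin.sum_univ_two, Matrix.of_apply, Matrix.cons_val',
    Matrix.cons_val_zero, Matrix.cons_val_one, Matrix.cons_val_fin_one]
  push_cast
  refine ⟨?_, ?_, ?_⟩
  · rw [← h1, ← h2]; linear_combination e1
  · rw [h1, h2]; linear_combination e2
  · rw [← h1, ← h2]; ring

lemma card_le : Nat.card Q7 ≤ 48 := by
  have hex : ∀ q : Q7, ∃ γ : SL(2, ℤ), q = QuotientGroup.mk ⟨Matrix.SpecialLinearGroup.mapGL ℝ γ, ⟨γ, rfl⟩⟩ := by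
    intro q
    induction q using QuotientGroup.induction_on with
    | H z => obtain ⟨z, γ, rfl⟩ := z; exact ⟨γ, rfl⟩
  choose s hs using hex
  have hinj : Function.Injective fun q ↦ (⟨col (s q), col_ne _⟩ : {v : ZMod 7 × ZMod 7 // v ≠ 0}) := by
    intro q r h
    have h' : col (s q) = col (s r) := congrArg Subtype.val h
    rw [hs q, hs r, QuotientGroup.eq, Subgroup.mem_subgroupOf]
    have := (mem_G7_iff _).mpr (mem_of_col_eq _ _ h')
    simpa using this
  refine (Nat.card_le_card_of_injective _ hinj).trans ?_
  rw [Nat.card_eq_fintype_card]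
  decide

lemma neg_one_mem : (-1 : GL (Fin 2) ℝ) ∈ 𝒮ℒ := ⟨-1, by ext; simp⟩

lemma neg_one_notMem : (-1 : GL (Fin 2) ℝ) ∉ G7 := by
  have : (-1 : GL (Fin 2) ℝ) = Matrix.SpecialLinearGroup.mapGL ℝ (-1 : SL(2, ℤ)) := by ext; simp
  rw [this, mem_G7_iff, Gamma1_mem]
  simp
  decide

theorem sturm {k : ℕ} (f : ModularForm G7 (k : ℤ))
    (h : ∀ i < 2 * k + 1, (qExpansion 1 f).coeff i = 0) : f = 0 := by
  suffices ModularForm.norm 𝒮ℒ f = 0 by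
    rw [ModularForm.norm_eq_zero_iff] at this
    exact DFunLike.coe_injective this
  have hf := isBigO_of_coeff_eq_zero one_mem_periods f _ h
  apply ModularForm.sturm_bound_levelOne
  have key : (ModularForm.norm 𝒮ℒ f) =O[atImInfty]
      fun τ : ℍ ↦ (Function.Periodic.qParam 1 τ) ^ (4 * k + 2) := by
    classical
    let : Fintype Q7 := Fintype.ofFinite Q7
    rw [ModularForm.coe_norm]
    set q1 : Q7 := QuotientGroup.mk 1
    set q2 : Q7 := QuotientGroup.mk ⟨-1, neg_one_mem⟩
    have hne : q1 ≠ q2 := by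
      intro he
      rw [QuotientGroup.eq, Subgroup.mem_subgroupOf] at he
      exact neg_one_notMem (by simpa using he)
    have hb : ∀ q : Q7, (SlashInvariantForm.quotientFunc f q) =O[atImInfty] (fun _ ↦ (1 : ℂ)) := by
      intro q
      induction q using QuotientGroup.induction_on with
      | H z =>
        obtain ⟨z, γ, rfl⟩ := z
        have := ModularFormClass.bdd_at_infty_slash f γ⁻¹
        have h' : IsBoundedAtImInfty (SlashInvariantForm.quotientFunc (ℋ := 𝒮ℒ) f
            (QuotientGroup.mk ⟨Matrix.SpecialLinearGroup.mapGL ℝ γ, ⟨γ, rfl⟩⟩)) := by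
          convert this using 1
          rw [ModularForm.SL_slash, map_inv]
          rfl
        exact IsBigO.trans h' (by simpa using isBigO_refl (fun _ : ℍ ↦ (1:ℝ)) atImInfty |>.norm_right)
    have h1 : SlashInvariantForm.quotientFunc f q1 = f := by
      have : SlashInvariantForm.quotientFunc f q1 = (f : ℍ → ℂ) ∣[(k:ℤ)] (1 : GL (Fin 2) ℝ)⁻¹ := rfl
      rw [this]; simp
    have h2 : SlashInvariantForm.quotientFunc f q2 = (-1 : ℂ) ^ k • (f : ℍ → ℂ) := by
      have : SlashInvariantForm.quotientFunc f q2 = (f : ℍ → ℂ) ∣[(k:ℤ)] (-1 : GL (Fin 2) ℝ)⁻¹ := rfl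
      rw [this]
      ext τ
      rw [ModularForm.slash_apply]
      have hdet : (-1 : Matrix (Fin 2) (Fin 2) ℝ).det = 1 := by simp [Matrix.det_fin_two]
      have hinv : ((-1 : ℂ)⁻¹) = -1 := by norm_num
      simp [σ, denom, hdet, mul_comm]
      left
      rw [← inv_pow, hinv]
    rw [← Finset.mul_prod_erase _ _ (Finset.mem_univ q1),
      ← Finset.mul_prod_erase _ _ (Finset.mem_erase.mpr ⟨hne.symm, Finset.mem_univ q2⟩), h1, h2]
    have h3 : (∏ q ∈ (Finset.univ.erase q1).erase q2, SlashInvariantForm.quotientFunc f q)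
        =O[atImInfty] (fun _ ↦ (1 : ℂ)) := by
      rw [Finset.prod_fn]
      simpa using IsBigO.finsetProd (s := (Finset.univ.erase q1).erase q2) fun q _ ↦ hb q
    have := hf.mul ((hf.const_mul_left ((-1 : ℂ) ^ k)).mul h3)
    refine this.congr_right fun τ ↦ ?_
    rw [mul_one, ← pow_add]
    congr 1
    omega
  have h2 := coeff_eq_zero_of_isBigO (by simp) _ _ key
  have h3 : ((4 * k + 2 : ℕ) : ℕ∞) ≤ (qExpansion 1 (ModularForm.norm 𝒮ℒ f)).order :=
    PowerSeries.le_order _ _ fun i hi ↦ h2 i (by exact_mod_cast hi)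
  refine lt_of_lt_of_le ?_ h3
  have := card_le
  have : ((k : ℤ) * (Nat.card Q7 : ℤ)).toNat ≤ 48 * k := by
    have : (k : ℤ) * (Nat.card Q7 : ℤ) = ((k * Nat.card Q7 : ℕ) : ℤ) := by push_cast; rfl
    rw [this, Int.toNat_natCast]
    nlinarith
  have h4 : ((k : ℤ) * (Nat.card Q7 : ℤ)).toNat / 12 < 4 * k + 2 := by omega
  exact_mod_cast h4

end Gam7

end PartB

section PartC

open UpperHalfPlane CongruenceSubgroup Filter Topology Asymptotics
open scoped MatrixGroups ModularForm

namespace Gam7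
noncomputable section

def AA (x : ℂ) : ℂ := x / (1 - x)

/-- `∑ X q^m / (1 - X q^m)` -/
def SS (q X : ℂ) : ℂ := ∑' m : ℕ, AA (X * q ^ m)

/-- The (normalised) Weierstrass-zeta like function in multiplicative coordinates. -/
def FF (q X : ℂ) : ℂ := 1 / 2 + SS q X - SS q (q / X)

lemma AA_bound {x : ℂ} (hx : ‖x‖ ≤ 1 / 2) : ‖AA x‖ ≤ 2 * ‖x‖ := by
  have h1 : 1 / 2 ≤ ‖1 - x‖ := by
    have := norm_sub_norm_le (1 : ℂ) x
    rw [norm_one] at this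
    linarith
  rw [AA, norm_div, div_le_iff₀ (by linarith)]
  nlinarith [norm_nonneg x]

lemma AA_add_inv {X : ℂ} (h0 : X ≠ 0) (h1 : X ≠ 1) : AA X + AA X⁻¹ = -1 := by
  have : 1 - X ≠ 0 := sub_ne_zero.mpr h1.symm
  have h2 : X - 1 ≠ 0 := sub_ne_zero.mpr h1
  have h3 : 1 - X⁻¹ ≠ 0 := by
    rw [sub_ne_zero]; intro h; exact h1 (inv_eq_one.mp h.symm)
  unfold AA
  field_simp
  rw [← neg_sub X 1]
  field_simp
  ring

lemma SS_summable {q : ℂ} (hq : ‖q‖ < 1) (X : ℂ) : Summable fun m : ℕ ↦ AA (X * q ^ m) := by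
  have hs : Summable fun m : ℕ ↦ 2 * (‖X‖ * ‖q‖ ^ m) :=
    ((summable_geometric_of_lt_one (norm_nonneg q) hq).mul_left _).mul_left _
  refine Summable.of_norm_bounded_eventually_nat hs ?_
  have ht : Tendsto (fun m : ℕ ↦ ‖X‖ * ‖q‖ ^ m) atTop (𝓝 (‖X‖ * 0)) :=
    (tendsto_pow_atTop_nhds_zero_of_lt_one (norm_nonneg q) hq).const_mul _
  rw [mul_zero] at ht
  filter_upwards [ht.eventually_le_const (show (0:ℝ) < 1 / 2 by norm_num)] with m hm
  have : ‖X * q ^ m‖ = ‖X‖ * ‖q‖ ^ m := by simp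
  rw [← this]
  exact AA_bound (this ▸ hm)

lemma SS_rec {q : ℂ} (hq : ‖q‖ < 1) (X : ℂ) : SS q X = AA X + SS q (q * X) := by
  unfold SS
  rw [(SS_summable hq X).tsum_eq_zero_add]
  simp only [pow_zero, mul_one]
  congr 2
  ext m
  congr 1
  ring

lemma SS_shift {q : ℂ} (hq : ‖q‖ < 1) (X : ℂ) (M : ℕ) :
    SS q X = ∑ m ∈ Finset.range M, AA (X * q ^ m) + SS q (X * q ^ M) := by
  unfold SS
  rw [← (SS_summable hq X).sum_add_tsum_nat_add M]
  congr 2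
  ext m
  congr 1
  ring

lemma SS_bound {q Y : ℂ} (hq : ‖q‖ ≤ 1 / 2) (hY : ‖Y‖ ≤ 1 / 2) : ‖SS q Y‖ ≤ 4 * ‖Y‖ := by
  have hg := (hasSum_geometric_of_lt_one (r := (1/2 : ℝ)) (by norm_num) (by norm_num)).mul_left
    (2 * ‖Y‖)
  have : ∀ m : ℕ, ‖AA (Y * q ^ m)‖ ≤ 2 * ‖Y‖ * (1 / 2) ^ m := by
    intro m
    have h1 : ‖Y * q ^ m‖ ≤ ‖Y‖ * (1 / 2) ^ m := by
      rw [norm_mul, norm_pow]; gcongr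
    have h2 : ‖Y‖ * (1 / 2) ^ m ≤ 1 / 2 := by
      have : ((1:ℝ) / 2) ^ m ≤ 1 := pow_le_one₀ (by norm_num) (by norm_num)
      nlinarith [norm_nonneg Y]
    have := AA_bound (h1.trans h2)
    linarith
  have := tsum_of_norm_bounded hg this
  unfold SS
  refine this.trans (le_of_eq ?_)
  norm_num
  ring

lemma FF_mul {q X : ℂ} (hq : ‖q‖ < 1) (hq0 : q ≠ 0) (h0 : X ≠ 0) (h1 : X ≠ 1) :
    FF q (q * X) = FF q X + 1 := by
  unfold FF
  have e1 := SS_rec hq X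
  have e2 := SS_rec hq X⁻¹
  have e3 : q / (q * X) = X⁻¹ := by field_simp
  have e4 : q * X⁻¹ = q / X := by field_simp
  have := AA_add_inv h0 h1
  rw [e3, e1, e2, e4]
  linear_combination -this

lemma FF_inv {q X : ℂ} (hq : ‖q‖ < 1) (h0 : X ≠ 0) (h1 : X ≠ 1) :
    FF q X⁻¹ = - FF q X := by
  unfold FF
  have e1 := SS_rec hq X
  have e2 := SS_rec hq X⁻¹
  have e3 : q / X⁻¹ = q * X := by field_simp
  have e4 : q * X⁻¹ = q / X := by field_simp
  have := AA_add_inv h0 h1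
  rw [e3, e1, e2, e4]
  linear_combination this

lemma SS_differentiableAt {q X : ℂ → ℂ} (hq : Differentiable ℂ q) (hX : Differentiable ℂ X)
    {t₀ : ℂ} (h1 : ‖q t₀‖ < 1) (hne : ∀ m : ℕ, X t₀ * q t₀ ^ m ≠ 1) :
    DifferentiableAt ℂ (fun t ↦ SS (q t) (X t)) t₀ := by
  obtain ⟨r, hr1, hr2⟩ := exists_between h1
  have hr0 : 0 ≤ r := (norm_nonneg _).trans hr1.le
  set C := ‖X t₀‖ + 1
  have hC0 : 0 < C := by positivity
  have ht : Tendsto (fun m : ℕ ↦ C * r ^ m) atTop (𝓝 (C * 0)) :=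
    (tendsto_pow_atTop_nhds_zero_of_lt_one hr0 hr2).const_mul _
  rw [mul_zero] at ht
  obtain ⟨M, hM⟩ := (ht.eventually_le_const (show (0:ℝ) < 1 / 2 by norm_num)).exists
  set U : Set ℂ := {t | ‖q t‖ < r ∧ ‖X t‖ < C}
  have hU : IsOpen U := (isOpen_lt hq.continuous.norm continuous_const).inter
    (isOpen_lt hX.continuous.norm continuous_const)
  have htU : t₀ ∈ U := ⟨hr1, by simp [C]⟩
  have hbd : ∀ (m : ℕ), ∀ t ∈ U, ‖X t * q t ^ M * q t ^ m‖ ≤ 1 / 2 * r ^ m := by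
    intro m t ht
    rw [norm_mul, norm_mul, norm_pow, norm_pow]
    have a1 : ‖X t‖ * ‖q t‖ ^ M ≤ 1 / 2 := by
      refine le_trans ?_ hM
      have := ht.1.le
      have := ht.2.le
      gcongr
    have := ht.1.le
    gcongr
  have hbd' : ∀ (m : ℕ), ∀ t ∈ U, ‖X t * q t ^ M * q t ^ m‖ ≤ 1 / 2 := by
    intro m t ht
    have := hbd m t ht
    have h' : r ^ m ≤ 1 := pow_le_one₀ hr0 hr2.le
    linarith
  have htail : DifferentiableOn ℂ (fun t ↦ SS (q t) (X t * q t ^ M)) U := by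
    unfold SS
    refine Complex.differentiableOn_tsum_of_summable_norm (u := fun m ↦ r ^ m)
      (summable_geometric_of_lt_one hr0 hr2) ?_ hU ?_
    · intro m t ht
      have hn : 1 - X t * q t ^ M * q t ^ m ≠ 0 := by
        intro h
        have h2 := hbd' m t ht
        rw [← sub_eq_zero.mp h, norm_one] at h2
        norm_num at h2
      unfold AA
      apply DifferentiableAt.differentiableWithinAt
      have h1 := hX t
      have h2 := hq t
      fun_prop (disch := exact hn)
    · intro m t ht
      have := AA_bound (hbd' m t ht)
      have := hbd m t ht
      linarith
  have hfin : DifferentiableAt ℂ (fun t ↦ ∑ m ∈ Finset.range M, AA (X t * q t ^ m)) t₀ := by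
    refine DifferentiableAt.fun_sum fun m _ ↦ ?_
    unfold AA
    have h1 := hX t₀
    have h2 := hq t₀
    have hn : 1 - X t₀ * q t₀ ^ m ≠ 0 := sub_ne_zero.mpr (hne m).symm
    fun_prop (disch := exact hn)
  have := hfin.add ((htail t₀ htU).differentiableAt (hU.mem_nhds htU))
  refine this.congr_of_eventuallyEq ?_
  filter_upwards [hU.mem_nhds htU] with t ht
  exact SS_shift (ht.1.trans hr2) _ _

end
end Gam7

end PartC

section PartD

open UpperHalfPlane CongruenceSubgroup Filter Topology Asymptotics
open scoped MatrixGroups ModularForm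

namespace Gam7
noncomputable section

/-- the lattice `ℤ + ℤτ` as period pair -/
def pp (τ : ℍ) : PeriodPair where
  ω₁ := 1
  ω₂ := τ
  indep := by
    rw [LinearIndependent.pair_iff]
    intro s t h
    have him := congrArg Complex.im h
    have hre := congrArg Complex.re h
    simp at him hre
    have ht : t = 0 := by
      rcases him with h | h
      · exact h
      · exact absurd h τ.im_ne_zero
    subst ht
    simpa using hre

def Lam (τ : ℍ) : Set ℂ := {z | ∃ m n : ℤ, z = m + n * τ}

lemma Lam_eq (τ : ℍ) : Lam τ = (pp τ).lattice := by
  ext z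
  simp only [Lam, Set.mem_ofPred_eq, SetLike.mem_coe, PeriodPair.mem_lattice, pp]
  simp [eq_comm]

lemma Lam_add_one {τ : ℍ} {z : ℂ} : z + 1 ∈ Lam τ ↔ z ∈ Lam τ := by
  constructor
  · rintro ⟨m, n, h⟩; exact ⟨m - 1, n, by push_cast; linear_combination h⟩
  · rintro ⟨m, n, h⟩; exact ⟨m + 1, n, by push_cast; linear_combination h⟩

lemma Lam_add_tau {τ : ℍ} {z : ℂ} : z + τ ∈ Lam τ ↔ z ∈ Lam τ := by
  constructor
  · rintro ⟨m, n, h⟩; exact ⟨m, n - 1, by push_cast; linear_combination h⟩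
  · rintro ⟨m, n, h⟩; exact ⟨m, n + 1, by push_cast; linear_combination h⟩

lemma Lam_neg {τ : ℍ} {z : ℂ} : -z ∈ Lam τ ↔ z ∈ Lam τ := by
  constructor
  · rintro ⟨m, n, h⟩; exact ⟨-m, -n, by push_cast; linear_combination -h⟩
  · rintro ⟨m, n, h⟩; exact ⟨-m, -n, by push_cast; linear_combination -h⟩

lemma Lam_isClosed (τ : ℍ) : IsClosed (Lam τ) := by
  rw [Lam_eq]; exact (pp τ).isClosed_lattice

lemma Lam_punctured (τ : ℍ) : ∀ᶠ z in 𝓝[≠] (0:ℂ), z ∉ Lam τ := by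
  have := (pp τ).compl_lattice_sdiff_singleton_mem_nhds 0
  rw [← Lam_eq] at this
  filter_upwards [nhdsWithin_le_nhds this, self_mem_nhdsWithin] with z hz h0 hL
  exact hz ⟨hL, h0⟩

lemma liouville (τ : ℍ) (D : ℂ → ℂ) (hd : ∀ z ∉ Lam τ, DifferentiableAt ℂ D z)
    (h1 : ∀ z ∉ Lam τ, D (z + 1) = D z) (h2 : ∀ z ∉ Lam τ, D (z + τ) = D z)
    (hodd : ∀ z ∉ Lam τ, D (-z) = - D z) {l : ℂ} (hl : Tendsto D (𝓝[≠] 0) (𝓝 l)) :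
    ∀ z ∉ Lam τ, D z = 0 := by
  classical
  set E : ℂ → ℂ := fun z ↦ if z ∈ Lam τ then l else D z with hE
  have E1 : ∀ z, E (z + 1) = E z := by
    intro z
    simp only [hE, Lam_add_one]
    split_ifs with h
    · rfl
    · exact h1 z h
  have E2 : ∀ z, E (z + τ) = E z := by
    intro z
    simp only [hE, Lam_add_tau]
    split_ifs with h
    · rfl
    · exact h2 z h
  have P1 : Function.Periodic E 1 := E1
  have P2 : Function.Periodic E (τ : ℂ) := E2
  have EL : ∀ z, ∀ m n : ℤ, E (z + (m + n * τ)) = E z := by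
    intro z m n
    rw [← add_assoc]
    have a := P2.int_mul n (z + m)
    have b := P1.int_mul m z
    rw [a]
    simpa using b
  have h0L : (0 : ℂ) ∈ Lam τ := ⟨0, 0, by simp⟩
  have hd0 : DifferentiableAt ℂ E 0 := by
    apply AnalyticAt.differentiableAt
    apply Complex.analyticAt_of_differentiable_on_punctured_nhds_of_continuousAt
    · filter_upwards [Lam_punctured τ] with z hz
      refine (hd z hz).congr_of_eventuallyEq ?_
      filter_upwards [(Lam_isClosed τ).isOpen_compl.mem_nhds hz] with w hw
      exact if_neg hw
    · rw [continuousAt_iff_punctured_nhds]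
      have : E 0 = l := if_pos h0L
      rw [this]
      refine hl.congr' ?_
      filter_upwards [Lam_punctured τ] with z hz
      exact (if_neg hz).symm
  have hdE : Differentiable ℂ E := by
    intro z
    by_cases hz : z ∈ Lam τ
    · obtain ⟨m, n, rfl⟩ := hz
      set w : ℂ := m + n * τ
      have : E = fun z ↦ E (z - w) := by
        ext z
        have := EL (z - w) m n
        rw [← this]; congr 1; ring
      rw [this]
      have h0 : DifferentiableAt ℂ E (w - w) := by rw [sub_self]; exact hd0
      exact DifferentiableAt.comp (f := fun z ↦ z - w) w h0 (by fun_prop)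
    · refine (hd z hz).congr_of_eventuallyEq ?_
      filter_upwards [(Lam_isClosed τ).isOpen_compl.mem_nhds hz] with w hw
      exact if_neg hw
  have hb : Bornology.IsBounded (Set.range E) := by
    have hK : IsCompact ((fun p : ℝ × ℝ ↦ E (p.1 + p.2 * τ)) '' (Set.Icc 0 1 ×ˢ Set.Icc 0 1)) := by
      apply IsCompact.image
      · exact isCompact_Icc.prod isCompact_Icc
      · have := hdE.continuous
        fun_prop
    refine hK.isBounded.subset ?_
    rintro _ ⟨z, rfl⟩
    set t : ℝ := z.im / τ.im
    set s : ℝ := z.re - t * τ.re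
    have hz : z = s + t * τ := by
      have := τ.im_ne_zero
      apply Complex.ext
      · simp [s]
      · simp [t]; field_simp
    refine ⟨(Int.fract s, Int.fract t), ⟨⟨Int.fract_nonneg _, (Int.fract_lt_one _).le⟩,
      ⟨Int.fract_nonneg _, (Int.fract_lt_one _).le⟩⟩, ?_⟩
    simp only
    rw [← EL _ ⌊s⌋ ⌊t⌋]
    congr 1
    rw [hz]
    have a : (s : ℂ) = ((Int.fract s : ℝ) : ℂ) + (⌊s⌋ : ℂ) := by
      have := Int.fract_add_floor s
      exact_mod_cast this.symm
    have b : (t : ℂ) = ((Int.fract t : ℝ) : ℂ) + (⌊t⌋ : ℂ) := by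
      have := Int.fract_add_floor t
      exact_mod_cast this.symm
    linear_combination -a - τ * b
  intro z hz
  have hc := hdE.apply_eq_apply_of_bounded hb z (-z)
  simp only [hE, if_neg hz, Lam_neg, hodd z hz] at hc
  linear_combination hc / 2

end
end Gam7

end PartD

section PartE

open UpperHalfPlane CongruenceSubgroup Filter Topology Asymptotics
open scoped MatrixGroups ModularForm

namespace Gam7
noncomputable section

/-- `e^{2πiz}` -/
def ee (z : ℂ) : ℂ := Complex.exp (2 * Real.pi * Complex.I * z)

lemma ee_add (z w : ℂ) : ee (z + w) = ee z * ee w := by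
  simp only [ee, mul_add, Complex.exp_add]

lemma ee_neg (z : ℂ) : ee (-z) = (ee z)⁻¹ := by
  simp only [ee, mul_neg, Complex.exp_neg]

lemma ee_sub (z w : ℂ) : ee (z - w) = ee z / ee w := by
  rw [sub_eq_add_neg, ee_add, ee_neg, div_eq_mul_inv]

lemma ee_ne_zero (z : ℂ) : ee z ≠ 0 := Complex.exp_ne_zero _

lemma ee_nat_mul (m : ℕ) (z : ℂ) : ee (m * z) = ee z ^ m := by
  simp only [ee, ← Complex.exp_nat_mul]; congr 1; ring

lemma ee_differentiable : Differentiable ℂ ee := by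
  unfold ee; fun_prop

lemma ee_eq_one {z : ℂ} : ee z = 1 ↔ ∃ n : ℤ, z = n := by
  unfold ee
  rw [Complex.exp_eq_one_iff]
  have : (2 * Real.pi * Complex.I : ℂ) ≠ 0 := Complex.two_pi_I_ne_zero
  constructor
  · rintro ⟨n, h⟩; exact ⟨n, by apply mul_left_cancel₀ this; linear_combination h⟩
  · rintro ⟨n, h⟩; exact ⟨n, by rw [h]; ring⟩

lemma ee_one : ee 1 = 1 := ee_eq_one.mpr ⟨1, by simp⟩

lemma norm_ee (z : ℂ) : ‖ee z‖ = Real.exp (-2 * Real.pi * z.im) := by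
  unfold ee
  rw [Complex.norm_exp]
  congr 1
  simp

lemma norm_ee_lt (τ : ℍ) : ‖ee τ‖ < 1 := by
  rw [norm_ee, Real.exp_lt_one_iff]
  have := τ.im_pos
  have := Real.pi_pos
  have h : (τ : ℂ).im = τ.im := rfl
  rw [h]
  nlinarith [mul_pos Real.pi_pos τ.im_pos]

/-- additive coordinates -/
def Fz (z : ℂ) (τ : ℂ) : ℂ := FF (ee τ) (ee z)

lemma ee_ne_one {τ : ℍ} {z : ℂ} (hz : z ∉ Lam τ) : ee z ≠ 1 := by
  intro h
  obtain ⟨n, hn⟩ := ee_eq_one.mp h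
  exact hz ⟨n, 0, by simp [hn]⟩

lemma Fz_add_one (z : ℂ) (τ : ℂ) : Fz (z + 1) τ = Fz z τ := by
  simp [Fz, ee_add, ee_one]

lemma Fz_T (z : ℂ) (τ : ℂ) : Fz z (τ + 1) = Fz z τ := by
  simp [Fz, ee_add, ee_one]

lemma Fz_add_tau {z : ℂ} {τ : ℍ} (hz : z ∉ Lam τ) : Fz (z + τ) τ = Fz z τ + 1 := by
  rw [Fz, ee_add, mul_comm, FF_mul (norm_ee_lt τ) (ee_ne_zero _) (ee_ne_zero _) (ee_ne_one hz)]
  rfl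

lemma Fz_neg {z : ℂ} {τ : ℍ} (hz : z ∉ Lam τ) : Fz (-z) τ = - Fz z τ := by
  rw [Fz, ee_neg, FF_inv (norm_ee_lt τ) (ee_ne_zero _) (ee_ne_one hz)]
  rfl

lemma ne_one_of {τ : ℍ} {z : ℂ} (hz : z ∉ Lam τ) (m : ℤ) : ee (z + m * τ) ≠ 1 := by
  intro h
  obtain ⟨n, hn⟩ := ee_eq_one.mp h
  exact hz ⟨n, -m, by push_cast; linear_combination hn⟩

/-- general differentiability: `z` an entire function of the parameter. -/
lemma Fz_differentiableAt {q z : ℂ → ℂ} (hq : Differentiable ℂ q) (hz : Differentiable ℂ z)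
    {t : ℂ} (τ : ℍ) (hτ : q t = τ) (h : z t ∉ Lam τ) :
    DifferentiableAt ℂ (fun t ↦ Fz (z t) (q t)) t := by
  unfold Fz FF
  have hq' : Differentiable ℂ (fun t ↦ ee (q t)) := ee_differentiable.comp hq
  have hz' : Differentiable ℂ (fun t ↦ ee (z t)) := ee_differentiable.comp hz
  have e : ∀ t, ee (q t) / ee (z t) = ee (q t - z t) := fun t ↦ (ee_sub _ _).symm
  simp only [e]
  have hz2 : Differentiable ℂ (fun t ↦ ee (q t - z t)) := ee_differentiable.comp (hq.sub hz)
  have h1 : ‖ee (q t)‖ < 1 := by rw [hτ]; exact norm_ee_lt τ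
  refine ((differentiableAt_const _).add (SS_differentiableAt hq' hz' h1 ?_)).sub
    (SS_differentiableAt hq' hz2 h1 ?_)
  · intro m
    rw [hτ, ← ee_nat_mul, ← ee_add]
    exact_mod_cast ne_one_of h m
  · intro m
    rw [hτ, ← ee_nat_mul, ← ee_add]
    have := ne_one_of (Lam_neg.not.mpr h) (m + 1)
    convert this using 2
    push_cast; ring

lemma P_tendsto : ∃ l : ℂ, Tendsto (fun z : ℂ ↦ 1 / 2 + AA (ee z) + 1 / (2 * Real.pi * Complex.I * z))
    (𝓝[≠] 0) (𝓝 l) := by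
  set h : ℂ → ℂ := dslope Complex.exp 0
  set k : ℂ → ℂ := dslope h 0
  have hh : Differentiable ℂ h := by
    have := (Complex.differentiableOn_dslope (f := Complex.exp) (c := 0) (s := Set.univ)
      univ_mem).mpr Complex.differentiable_exp.differentiableOn
    exact differentiableOn_univ.mp this
  have hk : Differentiable ℂ k := by
    have := (Complex.differentiableOn_dslope (f := h) (c := 0) (s := Set.univ)
      univ_mem).mpr hh.differentiableOn
    exact differentiableOn_univ.mp this
  have h0 : h 0 = 1 := by simp [h, dslope_same]
  have hu : Tendsto (fun z : ℂ ↦ 2 * Real.pi * Complex.I * z) (𝓝[≠] 0) (𝓝 0) := by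
    have : Continuous (fun z : ℂ ↦ 2 * Real.pi * Complex.I * z) := by fun_prop
    have := this.tendsto 0
    simp only [mul_zero] at this
    exact this.mono_left nhdsWithin_le_nhds
  have hc : Tendsto (fun u : ℂ ↦ 1 / 2 - 1 + k u / h u) (𝓝 0) (𝓝 (1 / 2 - 1 + k 0 / h 0)) := by
    refine tendsto_const_nhds.add (Tendsto.div hk.continuous.continuousAt hh.continuous.continuousAt ?_)
    rw [h0]; exact one_ne_zero
  refine ⟨_, (hc.comp hu).congr' ?_⟩
  have hev : ∀ᶠ z in 𝓝[≠] (0:ℂ), h (2 * Real.pi * Complex.I * z) ≠ 0 := by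
    have : Tendsto h (𝓝 0) (𝓝 1) := by
      have := hh.continuous.tendsto 0
      rwa [h0] at this
    exact (this.comp hu).eventually_ne one_ne_zero
  filter_upwards [hev, self_mem_nhdsWithin] with z hz hz0
  have hu0 : (2 * Real.pi * Complex.I * z : ℂ) ≠ 0 := mul_ne_zero Complex.two_pi_I_ne_zero hz0
  simp only [Function.comp_apply]
  unfold AA ee
  set u : ℂ := 2 * Real.pi * Complex.I * z
  have e1 : h u = (Complex.exp u - 1) / u := by
    simp [h, dslope_of_ne _ hu0, slope_def_field]
  have e2 : k u = (h u - 1) / u := by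
    simp [k, dslope_of_ne _ hu0, slope_def_field, h0]
  have e3 : Complex.exp u = 1 + u * h u := by rw [e1]; field_simp; ring
  rw [e2, e3]
  have : 1 - (1 + u * h u) ≠ 0 := by
    have : 1 - (1 + u * h u) = - (u * h u) := by ring
    rw [this]; exact neg_ne_zero.mpr (mul_ne_zero hu0 hz)
  have e4 : 1 - (1 + u * h u) = - (u * h u) := by ring
  rw [e4]
  field_simp
  ring

lemma Fz_tendsto (τ : ℍ) : ∃ l : ℂ, Tendsto (fun z : ℂ ↦ Fz z τ + 1 / (2 * Real.pi * Complex.I * z))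
    (𝓝[≠] 0) (𝓝 l) := by
  obtain ⟨l, hl⟩ := P_tendsto
  have hq : Differentiable ℂ (fun _ : ℂ ↦ ee τ) := by fun_prop
  have ne : ∀ m : ℕ, ee τ * ee τ ^ m ≠ 1 := by
    intro m h
    have h2 := congrArg norm h
    rw [← pow_succ', norm_pow, norm_one] at h2
    have := pow_lt_one₀ (norm_nonneg _) (norm_ee_lt τ) (Nat.succ_ne_zero m)
    exact this.ne h2
  have d1 : DifferentiableAt ℂ (fun z ↦ SS (ee τ) (ee (τ + z))) 0 := by
    refine SS_differentiableAt hq (ee_differentiable.comp (by fun_prop)) (norm_ee_lt τ) ?_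
    intro m; simpa using ne m
  have d2 : DifferentiableAt ℂ (fun z ↦ SS (ee τ) (ee (τ - z))) 0 := by
    refine SS_differentiableAt hq (ee_differentiable.comp (by fun_prop)) (norm_ee_lt τ) ?_
    intro m; simpa using ne m
  have t1 := d1.continuousAt.tendsto.mono_left (nhdsWithin_le_nhds (s := {0}ᶜ))
  have t2 := d2.continuousAt.tendsto.mono_left (nhdsWithin_le_nhds (s := {0}ᶜ))
  refine ⟨_, ((hl.add t1).sub t2).congr ?_⟩
  intro z
  unfold Fz FF
  rw [SS_rec (norm_ee_lt τ) (ee z), ee_add, ee_sub]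
  ring

lemma Fz_S (τ : ℍ) {z : ℂ} (hz : z ∉ Lam τ) :
    Fz (z / τ) (-1 / (τ : ℂ)) = τ * Fz z τ - z := by
  have hτ0 : (τ : ℂ) ≠ 0 := τ.ne_zero
  set τ' : ℍ := ModularGroup.S • τ
  have hτ' : (τ' : ℂ) = -1 / τ := by
    simp only [τ']; rw [UpperHalfPlane.modular_S_smul]; simp [neg_div, inv_neg]
  rw [← hτ']
  have hL : ∀ w : ℂ, w / (τ : ℂ) ∈ Lam τ' ↔ w ∈ Lam τ := by
    intro w
    constructor
    · rintro ⟨m, n, h⟩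
      refine ⟨-n, m, ?_⟩
      rw [hτ'] at h
      field_simp at h
      push_cast
      linear_combination h
    · rintro ⟨m, n, h⟩
      refine ⟨n, -m, ?_⟩
      rw [hτ', h]
      field_simp
      push_cast
      ring
  set D : ℂ → ℂ := fun z ↦ (τ : ℂ)⁻¹ * Fz (z / τ) τ' - Fz z τ + z / τ with hD
  have key : D z = 0 := by
    obtain ⟨l, hl⟩ := Fz_tendsto τ
    obtain ⟨l', hl'⟩ := Fz_tendsto τ'
    have hs : Tendsto (fun z : ℂ ↦ z / τ) (𝓝[≠] 0) (𝓝[≠] 0) := by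
      apply tendsto_nhdsWithin_of_tendsto_nhds_of_eventually_within
      · have : Continuous (fun z : ℂ ↦ z / τ) := by fun_prop
        have := this.tendsto 0
        simp only [zero_div] at this
        exact this.mono_left nhdsWithin_le_nhds
      · filter_upwards [self_mem_nhdsWithin] with z hz
        exact div_ne_zero hz hτ0
    have hid : Tendsto (fun z : ℂ ↦ z / τ) (𝓝[≠] 0) (𝓝 0) := hs.mono_right nhdsWithin_le_nhds
    have hlim := (((hl'.comp hs).const_mul (τ : ℂ)⁻¹).sub hl).add hid
    refine liouville τ D ?_ ?_ ?_ ?_ (hlim.congr' ?_) z hz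
    · intro w hw
      have a := Fz_differentiableAt (q := fun _ ↦ (τ : ℂ)) (z := fun z ↦ z) (by fun_prop)
        (by fun_prop) (t := w) τ rfl hw
      have b := Fz_differentiableAt (q := fun _ ↦ (τ' : ℂ)) (z := fun z ↦ z / τ) (by fun_prop)
        (by fun_prop) (t := w) τ' rfl ((hL w).not.mpr hw)
      exact ((b.const_mul _).sub a).add (by fun_prop)
    · intro w hw
      simp only [hD, Fz_add_one]
      have h2 : (w + 1) / τ ∉ Lam τ' := by rw [hL, Lam_add_one]; exact hw
      have e := Fz_add_tau h2
      have e2 : (w + 1) / τ + τ' = w / τ := by rw [hτ']; ring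
      rw [e2] at e
      rw [e]
      ring
    · intro w hw
      simp only [hD]
      rw [Fz_add_tau hw]
      have e2 : (w + τ) / τ = w / τ + 1 := by field_simp
      rw [e2, Fz_add_one]
      ring
    · intro w hw
      simp only [hD]
      rw [Fz_neg hw, neg_div, Fz_neg ((hL w).not.mpr hw)]
      ring
    · filter_upwards [self_mem_nhdsWithin] with w hw
      have hw : w ≠ 0 := hw
      have : (2 * Real.pi * Complex.I : ℂ) ≠ 0 := Complex.two_pi_I_ne_zero
      simp only [hD, Function.comp_apply]
      have : 1 / (2 * Real.pi * Complex.I * (w / τ)) = τ * (1 / (2 * Real.pi * Complex.I * w)) := by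
        rw [← mul_div_assoc, one_div_div, mul_one_div]
      rw [this]
      field_simp
      ring
  simp only [hD] at key
  field_simp at key
  linear_combination key

end
end Gam7

end PartE

section PartF

open UpperHalfPlane CongruenceSubgroup Filter Topology Asymptotics
open scoped MatrixGroups ModularForm Manifold

namespace Gam7
noncomputable section

/-- The weight one Eisenstein-type functions of level 7. -/
def hg (a b : ℤ) (τ : ℍ) : ℂ := Fz ((a * τ + b) / 7) τ - a / 7

def Nz (a b : ℤ) : Prop := ¬ ((7 : ℤ) ∣ a ∧ (7 : ℤ) ∣ b)

lemma notMem_Lam {a b : ℤ} (h : Nz a b) (τ : ℍ) : ((a * τ + b) / 7 : ℂ) ∉ Lam τ := by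
  rintro ⟨m, n, e⟩
  have e' : (a * τ + b : ℂ) = 7 * m + 7 * n * τ := by linear_combination 7 * e
  have him := congrArg Complex.im e'
  have hre := congrArg Complex.re e'
  simp at him hre
  have ha : (a : ℝ) = 7 * n := by
    rcases him with h | h
    · exact h
    · exact absurd h τ.im_ne_zero
  rw [ha] at hre
  have hb : (b : ℝ) = 7 * m := by linarith
  exact h ⟨⟨n, by exact_mod_cast ha⟩, ⟨m, by exact_mod_cast hb⟩⟩

lemma hg_add_b (a b n : ℤ) (τ : ℍ) : hg a (b + 7 * n) τ = hg a b τ := by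
  have P : Function.Periodic (fun z ↦ Fz z τ) 1 := fun z ↦ Fz_add_one z τ
  have := P.int_mul n ((a * τ + b) / 7)
  unfold hg
  rw [← this]
  congr 2
  push_cast; ring

lemma hg_add_a_one {a b : ℤ} (h : Nz a b) (τ : ℍ) : hg (a + 7) b τ = hg a b τ := by
  unfold hg
  have e : (((a + 7 : ℤ) * τ + b) / 7 : ℂ) = (a * τ + b) / 7 + τ := by push_cast; ring
  rw [e, Fz_add_tau (notMem_Lam h τ)]
  push_cast; ring

lemma Nz_shift {a b : ℤ} (n : ℤ) : Nz (a + 7 * n) b ↔ Nz a b := by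
  unfold Nz; rw [Int.dvd_add_left ⟨n, rfl⟩]

lemma hg_add_a {a b : ℤ} (h : Nz a b) (n : ℤ) (τ : ℍ) : hg (a + 7 * n) b τ = hg a b τ := by
  induction n using Int.induction_on with
  | zero => simp
  | succ i ih =>
    rw [← ih, ← hg_add_a_one (a := a + 7 * i) ((Nz_shift _).mpr h)]
    congr 1; ring
  | pred i ih =>
    rw [← ih, ← hg_add_a_one (a := a + 7 * (-i - 1)) ((Nz_shift _).mpr h)]
    congr 1; ring

lemma hg_congr {a b a' b' : ℤ} (h : Nz a b) (ha : (7 : ℤ) ∣ a' - a) (hb : (7 : ℤ) ∣ b' - b) :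
    hg a' b' = hg a b := by
  obtain ⟨m, hm⟩ := ha
  obtain ⟨n, hn⟩ := hb
  obtain rfl : a' = a + 7 * m := by linarith
  obtain rfl : b' = b + 7 * n := by linarith
  ext τ
  rw [hg_add_b, hg_add_a h]

lemma hg_T (a b : ℤ) : hg a b ∣[(1:ℤ)] ModularGroup.T = hg a (a + b) := by
  ext τ
  rw [ModularForm.SL_slash_apply, ModularGroup.denom_apply, modular_T_smul]
  simp only [ModularGroup.T, hg]
  have e1 : (((1 : ℝ) +ᵥ τ : ℍ) : ℂ) = τ + 1 := by simp [add_comm]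
  rw [e1, Fz_T]
  have e : (a * (τ + 1) + b : ℂ) = a * τ + (a + b : ℤ) := by push_cast; ring
  rw [e]
  simp

lemma hg_S {a b : ℤ} (h : Nz b (-a)) : hg a b ∣[(1:ℤ)] ModularGroup.S = hg b (-a) := by
  ext τ
  have hτ0 : (τ : ℂ) ≠ 0 := τ.ne_zero
  rw [ModularForm.SL_slash_apply, ModularGroup.denom_apply, modular_S_smul]
  have e1 : ((UpperHalfPlane.mk (-(τ : ℂ))⁻¹ τ.im_inv_neg_coe_pos : ℍ) : ℂ) = -1 / τ := by
    simp [neg_div, inv_neg]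
  have h3 := Fz_S τ (notMem_Lam h τ)
  unfold hg
  rw [e1]
  have e2 : ((a * (-1 / (τ : ℂ)) + b) / 7 : ℂ) = (b * τ + (-a : ℤ)) / 7 / τ := by
    push_cast; field_simp; ring
  rw [e2, h3]
  simp only [ModularGroup.S]
  simp
  field_simp
  ring

lemma Nz_mul {a b : ℤ} (h : Nz a b) (γ : SL(2, ℤ)) :
    Nz (a * γ 0 0 + b * γ 1 0) (a * γ 0 1 + b * γ 1 1) := by
  rintro ⟨h1, h2⟩
  have hdet := γ.det_coe
  rw [Matrix.det_fin_two] at hdet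
  obtain ⟨m, hm⟩ := h1
  obtain ⟨n, hn⟩ := h2
  refine h ⟨⟨m * γ 1 1 - n * γ 1 0, ?_⟩, ⟨n * γ 0 0 - m * γ 0 1, ?_⟩⟩
  · linear_combination -a * hdet + γ 1 1 * hm - γ 1 0 * hn
  · linear_combination -b * hdet + γ 0 0 * hn - γ 0 1 * hm

lemma hg_slash (γ : SL(2, ℤ)) : ∀ a b : ℤ, Nz a b → hg a b ∣[(1:ℤ)] γ =
    hg (a * γ 0 0 + b * γ 1 0) (a * γ 0 1 + b * γ 1 1) := by
  have hγ : γ ∈ Subgroup.closure {ModularGroup.S, ModularGroup.T} := by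
    rw [_root_.SpecialLinearGroup.SL2Z_generators]; trivial
  induction hγ using Subgroup.closure_induction with
  | mem x hx =>
    intro a b h
    rcases hx with rfl | rfl
    · have := Nz_mul h ModularGroup.S
      simp [ModularGroup.S] at this
      rw [hg_S this]
      simp [ModularGroup.S]
    · rw [hg_T]
      simp [ModularGroup.T]
  | one => intro a b h; simp
  | mul x y _ _ hx hy =>
    intro a b h
    rw [SlashAction.slash_mul, hx a b h, hy _ _ (Nz_mul h x)]
    congr 1 <;> simp [Matrix.mul_apply, Fin.sum_univ_two] <;> ring
  | inv x _ hx =>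
    intro a b h
    have := hx _ _ (Nz_mul h x⁻¹)
    have e : ∀ i j : Fin 2, (x⁻¹ * x) i j = (1 : Matrix (Fin 2) (Fin 2) ℤ) i j := by
      intro i j; rw [inv_mul_cancel]; rfl
    simp only [Matrix.SpecialLinearGroup.coe_mul, Matrix.mul_apply, Fin.sum_univ_two] at e
    have e00 := e 0 0
    have e01 := e 0 1
    have e10 := e 1 0
    have e11 := e 1 1
    simp only [Matrix.one_apply_eq, ne_eq, zero_ne_one, one_ne_zero, not_false_eq_true,
      Matrix.one_apply_ne] at e00 e01 e10 e11
    have ha : (a * x⁻¹ 0 0 + b * x⁻¹ 1 0) * x 0 0 + (a * x⁻¹ 0 1 + b * x⁻¹ 1 1) * x 1 0 = a := by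
      linear_combination a * e00 + b * e10
    have hb : (a * x⁻¹ 0 0 + b * x⁻¹ 1 0) * x 0 1 + (a * x⁻¹ 0 1 + b * x⁻¹ 1 1) * x 1 1 = b := by
      linear_combination a * e01 + b * e11
    rw [ha, hb] at this
    rw [← this, ← SlashAction.slash_mul, mul_inv_cancel, SlashAction.slash_one]

lemma ee_tendsto (α : ℝ) (hα : 0 < α) (β : ℂ) :
    Tendsto (fun τ : ℍ ↦ ee (α * τ + β)) atImInfty (𝓝 0) := by
  rw [tendsto_zero_iff_norm_tendsto_zero]
  simp only [norm_ee]
  have h1 : Tendsto (fun y : ℝ ↦ Real.exp (-2 * Real.pi * (α * y + β.im))) atTop (𝓝 0) := by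
    apply Real.tendsto_exp_atBot.comp
    have : Tendsto (fun y : ℝ ↦ α * y + β.im) atTop atTop :=
      tendsto_atTop_add_const_right _ _ (tendsto_id.const_mul_atTop hα)
    exact this.const_mul_atTop_of_neg (by linarith [Real.pi_pos])
  refine (h1.comp tendsto_comap).congr ?_
  intro τ
  simp

lemma SS_tendsto {q Y : ℍ → ℂ} (hq : Tendsto q atImInfty (𝓝 0))
    (hY : Tendsto Y atImInfty (𝓝 0)) : Tendsto (fun τ ↦ SS (q τ) (Y τ)) atImInfty (𝓝 0) := by
  have hn : Tendsto (fun τ ↦ 4 * ‖Y τ‖) atImInfty (𝓝 0) := by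
    simpa using hY.norm.const_mul 4
  have q1 := (hq.norm).eventually_le_const (u := 1 / 2) (by simp)
  have Y1 := (hY.norm).eventually_le_const (u := 1 / 2) (by simp)
  refine squeeze_zero_norm' ?_ hn
  filter_upwards [q1, Y1] with τ h1 h2
  exact SS_bound h1 h2

lemma ee_tau_tendsto : Tendsto (fun τ : ℍ ↦ ee τ) atImInfty (𝓝 0) := by
  simpa using ee_tendsto 1 one_pos 0

lemma hg_tendsto {a : ℤ} (b : ℤ) (h0 : 0 < a) (h7 : a < 7) :
    Tendsto (hg a b) atImInfty (𝓝 (1 / 2 - a / 7)) := by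
  have h0' : (0 : ℝ) < a := by exact_mod_cast h0
  have h7' : (a : ℝ) < 7 := by exact_mod_cast h7
  have t1 := SS_tendsto ee_tau_tendsto (ee_tendsto (a / 7) (by positivity) (b / 7))
  have t2 := SS_tendsto ee_tau_tendsto (ee_tendsto (1 - a / 7) (by linarith) (-b / 7))
  have := ((tendsto_const_nhds (x := (1 / 2 : ℂ))).add t1).sub t2 |>.sub
    (tendsto_const_nhds (x := (a / 7 : ℂ)))
  simp only [add_zero, sub_zero] at this
  refine this.congr ?_
  intro τ
  unfold hg Fz FF
  rw [← ee_sub]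
  congr 5 <;> push_cast <;> ring

lemma hg_tendsto_zero (b : ℤ) : Tendsto (hg 0 b) atImInfty (𝓝 (1 / 2 + AA (ee (b / 7)))) := by
  have t1 := SS_tendsto ee_tau_tendsto (ee_tendsto 1 one_pos (b / 7))
  have t2 := SS_tendsto ee_tau_tendsto (ee_tendsto 1 one_pos (-b / 7))
  have := ((tendsto_const_nhds (x := (1 / 2 + AA (ee (b / 7)) : ℂ))).add t1).sub t2
  simp only [add_zero, sub_zero] at this
  refine this.congr ?_
  intro τ
  unfold hg Fz FF
  have e1 : ((0 : ℤ) * (τ : ℂ) + b) / 7 = (b / 7 : ℂ) := by push_cast; ring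
  have e2 : ((1 : ℝ) * (τ : ℂ) + b / 7) = (τ + b / 7 : ℂ) := by push_cast; ring
  have e3 : ((1 : ℝ) * (τ : ℂ) + -b / 7) = (τ - b / 7 : ℂ) := by push_cast; ring
  rw [e1, e2, e3, ← ee_sub, SS_rec (norm_ee_lt τ) (ee (b / 7)), ← ee_add]
  push_cast; ring

lemma hg_bdd {a b : ℤ} (h : Nz a b) : IsBoundedAtImInfty (hg a b) := by
  suffices ∃ l, Tendsto (hg a b) atImInfty (𝓝 l) by
    obtain ⟨l, hl⟩ := this
    exact hl.isBigO_one ℝ |>.trans (by simpa using! isBigO_refl _ _)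
  have hr : Nz (a % 7) b := by
    have := (Nz_shift (a := a % 7) (b := b) (a / 7)).mp (by rwa [Int.emod_add_mul_ediv])
    exact this
  have e : hg a b = hg (a % 7) b := hg_congr hr (by omega) (by simp)
  rw [e]
  rcases (Int.emod_nonneg a (b := 7) (by norm_num)).eq_or_lt with h0 | h0
  · rw [← h0]; exact ⟨_, hg_tendsto_zero b⟩
  · exact ⟨_, hg_tendsto b h0 (Int.emod_lt_of_pos a (by norm_num))⟩

lemma hg_holo {a b : ℤ} (h : Nz a b) : MDiff (hg a b) := by
  rw [UpperHalfPlane.mdifferentiable_iff]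
  intro t ht
  have hd := Fz_differentiableAt (q := fun t ↦ t) (z := fun t ↦ (a * t + b) / 7) (by fun_prop)
    (by fun_prop) (t := t) ⟨t, ht⟩ rfl (notMem_Lam h _)
  have hd2 : DifferentiableAt ℂ (fun t : ℂ ↦ Fz ((a * t + b) / 7) t - a / 7) t :=
    hd.sub (differentiableAt_const _)
  refine (hd2.congr_of_eventuallyEq ?_).differentiableWithinAt
  filter_upwards [isOpen_upperHalfPlaneSet.mem_nhds ht] with w hw
  simp only [Function.comp_apply, hg, ofComplex_apply_of_im_pos hw]

/-- The weight one forms `h_{0,b}`. -/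
def HF (b : ℤ) (hb : Nz 0 b) : ModularForm G7 ((1 : ℕ) : ℤ) where
  toFun := hg 0 b
  slash_action_eq' := by
    rintro _ ⟨γ, hγ, rfl⟩
    have e := hg_slash γ 0 b hb
    have hγ' := (Gamma1_mem 7 γ).mp hγ
    rw [hg_congr hb (a' := 0 * γ 0 0 + b * γ 1 0) (b' := 0 * γ 0 1 + b * γ 1 1)] at e
    · exact e
    · have := (ZMod.intCast_zmod_eq_zero_iff_dvd (γ 1 0) 7).mp hγ'.2.2
      push_cast at this
      simpa using this.mul_left b
    · have : ((γ 1 1 - 1 : ℤ) : ZMod 7) = 0 := by push_cast; rw [hγ'.2.1]; simp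
      have := (ZMod.intCast_zmod_eq_zero_iff_dvd _ 7).mp this
      push_cast at this
      obtain ⟨m, hm⟩ := this
      exact ⟨b * m, by linear_combination b * hm⟩
  holo' := hg_holo hb
  bdd_at_cusps' := by
    intro c hc
    rw [Subgroup.IsArithmetic.isCusp_iff_isCusp_SL2Z] at hc
    rw [OnePoint.isBoundedAt_iff_forall_SL2Z hc]
    intro γ _
    have e := hg_slash γ 0 b hb
    have : IsBoundedAtImInfty (hg 0 b ∣[(1:ℤ)] γ) := by
      rw [e]; exact hg_bdd (Nz_mul hb γ)
    exact this

def bot (c : ℤ) : SL(2, ℤ) := ⟨!![1, 0; c, 1], by simp⟩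

lemma HF_apply (b : ℤ) (hb : Nz 0 b) (τ : ℍ) : HF b hb τ = hg 0 b τ := rfl

lemma hg_bot (b c : ℤ) (hb : Nz 0 b) (τ : ℍ) : hg 0 b (bot c • τ) * (denom (bot c) τ) ^ (-1 : ℤ)
    = hg (b * c) b τ := by
  have e := congrFun (hg_slash (bot c) 0 b hb) τ
  rw [ModularForm.SL_slash_apply] at e
  rw [e]
  simp [bot]

lemma nz1 : Nz 0 1 := by unfold Nz; decide
lemma nz2 : Nz 0 2 := by unfold Nz; decide
lemma nz3 : Nz 0 3 := by unfold Nz; decide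

lemma HF_indep : LinearIndependent ℂ ![HF 1 nz1, HF 2 nz2, HF 3 nz3] := by
  rw [Fintype.linearIndependent_iff]
  intro g hgz
  have h0 : ∀ τ : ℍ, g 0 * hg 0 1 τ + g 1 * hg 0 2 τ + g 2 * hg 0 3 τ = 0 := by
    intro τ
    have := DFunLike.congr_fun hgz τ
    simp only [Fin.sum_univ_three] at this
    simp at this
    exact this
  have h1 : ∀ c : ℤ, ∀ τ : ℍ, g 0 * hg (1 * c) 1 τ + g 1 * hg (2 * c) 2 τ + g 2 * hg (3 * c) 3 τ = 0 := by
    intro c τ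
    rw [← hg_bot 1 c nz1, ← hg_bot 2 c nz2, ← hg_bot 3 c nz3]
    linear_combination (denom (bot c) τ) ^ (-1 : ℤ) * h0 (bot c • τ)
  have lim : ∀ c a1 a2 a3 : ℤ, Nz a1 1 → Nz a2 2 → Nz a3 3 → 0 < a1 → a1 < 7 → 0 < a2 → a2 < 7 → 0 < a3 →
      a3 < 7 → (7 : ℤ) ∣ 1 * c - a1 → (7 : ℤ) ∣ 2 * c - a2 → (7 : ℤ) ∣ 3 * c - a3 →
      g 0 * (1 / 2 - a1 / 7) + g 1 * (1 / 2 - a2 / 7) + g 2 * (1 / 2 - a3 / 7) = 0 := by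
    intro c a1 a2 a3 n1 n2 n3 p1 q1 p2 q2 p3 q3 d1 d2 d3
    have t := (((hg_tendsto 1 p1 q1).const_mul (g 0)).add ((hg_tendsto 2 p2 q2).const_mul (g 1))).add
      ((hg_tendsto 3 p3 q3).const_mul (g 2))
    have z : Tendsto (fun _ : ℍ ↦ (0 : ℂ)) atImInfty (𝓝 0) := tendsto_const_nhds
    refine tendsto_nhds_unique (t.congr ?_) z
    intro τ
    rw [← h1 c τ, hg_congr n1 d1 (by simp), hg_congr n2 d2 (by simp), hg_congr n3 d3 (by simp)]
  have N : ∀ a b : ℤ, ¬ (7 : ℤ) ∣ b → Nz a b := fun a b hb h ↦ hb h.2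
  have l1 := lim 1 1 2 3 (N _ _ (by decide)) (N _ _ (by decide)) (N _ _ (by decide)) (by decide) (by decide)
    (by decide) (by decide) (by decide) (by decide) (by decide) (by decide) (by decide)
  have l2 := lim 2 2 4 6 (N _ _ (by decide)) (N _ _ (by decide)) (N _ _ (by decide)) (by decide) (by decide)
    (by decide) (by decide) (by decide) (by decide) (by decide) (by decide) (by decide)
  have l3 := lim 3 3 6 2 (N _ _ (by decide)) (N _ _ (by decide)) (N _ _ (by decide)) (by decide) (by decide)
    (by decide) (by decide) (by decide) (by decide) (by decide) (by decide) (by decide)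
  push_cast at l1 l2 l3
  have k1 : 5 * g 0 + 3 * g 1 + g 2 = 0 := by linear_combination 14 * l1
  have k2 : 3 * g 0 - g 1 - 5 * g 2 = 0 := by linear_combination 14 * l2
  have k3 : g 0 - 5 * g 1 + 3 * g 2 = 0 := by linear_combination 14 * l3
  have g2 : g 2 = 0 := by linear_combination k1 / 14 - k2 / 7 + k3 / 14
  have g1 : g 1 = 0 := by linear_combination k1 / 14 - k2 / 14 - k3 / 7
  have g0 : g 0 = 0 := by linear_combination k1 / 7 + k2 / 14 + k3 / 14
  intro i
  fin_cases i <;> assumption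

end
end Gam7

end PartF

section PartG

open UpperHalfPlane CongruenceSubgroup Filter Topology Asymptotics
open scoped MatrixGroups ModularForm

namespace Gam7
noncomputable section

/-- truncation of the q-expansion -/
def Tk (k : ℕ) : ModularForm G7 (k : ℤ) →ₗ[ℂ] (Fin (2 * k + 1) → ℂ) where
  toFun f := fun i ↦ (qExpansion 1 f).coeff i
  map_add' f g := by
    ext i
    have := ModularForm.qExpansion_add one_pos one_mem_periods f g
    simp only [FunLike.coe_add, this]
    simp
  map_smul' a f := by
    ext i
    have := ModularForm.qExpansion_smul one_pos one_mem_periods a f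
    have e : (⇑(a • f) : ℍ → ℂ) = a • ⇑f := rfl
    rw [e, this]
    simp

lemma Tk_injective (k : ℕ) : Function.Injective (Tk k) := by
  rw [injective_iff_map_eq_zero]
  intro f hf
  refine sturm f fun i hi ↦ ?_
  exact congrFun hf ⟨i, hi⟩

lemma T1_surjective : Function.Surjective (Tk 1) := by
  have hfin : FiniteDimensional ℂ (ModularForm G7 ((1 : ℕ) : ℤ)) :=
    FiniteDimensional.of_injective (Tk 1) (Tk_injective 1)
  have h1 := HF_indep.fintype_card_le_finrank
  have h2 := LinearMap.finrank_le_finrank_of_injective (Tk_injective 1)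
  simp at h1 h2
  refine (LinearMap.injective_iff_surjective_of_finrank_eq_finrank ?_).mp (Tk_injective 1)
  simp
  omega

/-- the power series starts with `q^j` -/
def Starts (p : PowerSeries ℂ) (j : ℕ) : Prop := (∀ i < j, p.coeff i = 0) ∧ p.coeff j = 1

lemma Starts.mul {p r : PowerSeries ℂ} {i j : ℕ} (hp : Starts p i) (hr : Starts r j) :
    Starts (p * r) (i + j) := by
  obtain ⟨u, rfl⟩ := PowerSeries.X_pow_dvd_iff.mpr hp.1
  obtain ⟨v, rfl⟩ := PowerSeries.X_pow_dvd_iff.mpr hr.1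
  have h1 := hp.2
  have h2 := hr.2
  have e : PowerSeries.X ^ i * u * (PowerSeries.X ^ j * v) = PowerSeries.X ^ (i + j) * (u * v) := by
    ring
  rw [PowerSeries.coeff_X_pow_mul'] at h1 h2
  simp at h1 h2
  rw [e]
  refine ⟨PowerSeries.X_pow_dvd_iff.mp (Dvd.intro _ rfl), ?_⟩
  rw [PowerSeries.coeff_X_pow_mul']
  simp [h1, h2]

lemma exists_starts (k : ℕ) : ∀ j ≤ 2 * k, ∃ f : ModularForm G7 (k : ℤ), Starts (qExpansion 1 f) j := by
  induction k with
  | zero =>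
    intro j hj
    obtain rfl : j = 0 := by omega
    refine ⟨(1 : ModularForm G7 0), ?_⟩
    have : qExpansion 1 (1 : ModularForm G7 0) = 1 := qExpansion_one 1
    refine ⟨by simp, ?_⟩
    have e := congrArg (PowerSeries.coeff 0) this
    simpa using e
  | succ k ih =>
    intro j hj
    obtain ⟨a, b, ha, hb, rfl⟩ : ∃ a b, a ≤ 2 * k ∧ b ≤ 2 ∧ j = a + b := by
      by_cases h : j ≤ 2 * k
      · exact ⟨j, 0, h, by omega, by omega⟩
      · exact ⟨2 * k, j - 2 * k, le_rfl, by omega, by omega⟩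
    obtain ⟨f, hf⟩ := ih a ha
    obtain ⟨g, hg⟩ := T1_surjective (fun i ↦ if (i : ℕ) = b then 1 else 0)
    have hgs : Starts (qExpansion 1 g) b := by
      constructor
      · intro i hi
        have := congrFun hg ⟨i, by omega⟩
        simpa [Tk, hi.ne] using this
      · have := congrFun hg ⟨b, by omega⟩
        simpa [Tk] using this
    refine ⟨ModularForm.mcast (by push_cast; ring) (f.mul g), ?_⟩
    have e := ModularForm.qExpansion_mul one_pos one_mem_periods f g
    have := hf.mul hgs
    rw [← e] at this
    exact this

lemma exists_coeffs (k : ℕ) (c : ℕ → ℂ) : ∀ n ≤ 2 * k + 1, ∃ f : ModularForm G7 (k : ℤ),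
    ∀ i < n, (qExpansion 1 f).coeff i = c i := by
  intro n
  induction n with
  | zero => intro _; exact ⟨0, by simp⟩
  | succ n ih =>
    intro hn
    obtain ⟨f, hf⟩ := ih (by omega)
    obtain ⟨g, hg⟩ := exists_starts k n (by omega)
    set a := c n - (qExpansion 1 f).coeff n
    refine ⟨f + a • g, fun i hi ↦ ?_⟩
    have h1 : (qExpansion 1 (f + a • g)).coeff i =
        (qExpansion 1 f).coeff i + a * (qExpansion 1 g).coeff i := by
      have := congrFun ((Tk k).map_add f (a • g)) ⟨i, by omega⟩
      rw [(Tk k).map_smul] at this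
      exact this
    refine Eq.trans h1 ?_
    rcases Nat.lt_succ_iff_lt_or_eq.mp hi with h | rfl
    · rw [hg.1 i h, hf i h]; ring
    · rw [hg.2]; simp only [a]; ring

lemma Tk_surjective (k : ℕ) : Function.Surjective (Tk k) := by
  intro c
  obtain ⟨f, hf⟩ := exists_coeffs k (fun i ↦ if h : i < 2 * k + 1 then c ⟨i, h⟩ else 0) _ le_rfl
  refine ⟨f, ?_⟩
  ext i
  have := hf i i.2
  rw [dif_pos i.2] at this
  exact this

lemma qParam_one (τ : ℂ) : Function.Periodic.qParam 1 τ =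
    Complex.exp (2 * Real.pi * Complex.I * τ) := by
  simp [Function.Periodic.qParam]

lemma cusp_diff {k : ℕ} (f : ModularForm G7 (k : ℤ)) :
    DifferentiableOn ℂ (cuspFunction 1 f) (Metric.ball 0 1) := by
  intro q hq
  exact (ModularFormClass.differentiableAt_cuspFunction f one_pos one_mem_periods
    (by simpa using hq)).differentiableWithinAt

lemma cusp_eq {k : ℕ} (f : ModularForm G7 (k : ℤ)) (τ : ℍ) :
    f τ = cuspFunction 1 f (Complex.exp (2 * Real.pi * Complex.I * (τ : ℂ))) := by
  rw [← qParam_one]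
  exact (SlashInvariantFormClass.eq_cuspFunction f τ one_mem_periods one_ne_zero).symm

lemma eventually_eq {k : ℕ} (f : ModularForm G7 (k : ℤ)) (g : ℂ → ℂ)
    (hg : DifferentiableOn ℂ g (Metric.ball (0 : ℂ) 1))
    (h : ∀ τ : ℍ, f τ = g (Complex.exp (2 * Real.pi * Complex.I * (τ : ℂ)))) :
    g =ᶠ[𝓝 0] cuspFunction 1 f := by
  have hb : Metric.ball (0 : ℂ) 1 ∈ 𝓝 (0 : ℂ) := Metric.ball_mem_nhds _ one_pos
  have c1 : ContinuousAt g 0 := (hg.differentiableAt hb).continuousAt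
  have c2 : ContinuousAt (cuspFunction 1 f) 0 := ((cusp_diff f).differentiableAt hb).continuousAt
  have hp : ∀ q ∈ Metric.ball (0 : ℂ) 1, q ≠ 0 → g q = cuspFunction 1 f q := by
    intro q hq h0
    have him := Function.Periodic.im_invQParam_pos_of_norm_lt_one (h := 1) one_pos (by simpa using hq) h0
    have e := Function.Periodic.qParam_right_inv (h := 1) one_ne_zero h0
    have h1 := h ⟨_, him⟩
    have h2 := cusp_eq f ⟨_, him⟩
    rw [← qParam_one] at h1 h2
    simp only at h1 h2
    rw [e] at h1 h2
    rw [← h1, ← h2]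
  have hev : g =ᶠ[𝓝[≠] 0] cuspFunction 1 f := by
    filter_upwards [nhdsWithin_le_nhds hb, self_mem_nhdsWithin] with q hq h0
    exact hp q hq h0
  exact (ContinuousAt.eventuallyEq_nhds_iff_eventuallyEq_nhdsNE c1 c2).mp hev

lemma iter_eq {k : ℕ} (f : ModularForm G7 (k : ℤ)) (g : ℂ → ℂ)
    (hg : DifferentiableOn ℂ g (Metric.ball (0 : ℂ) 1))
    (h : ∀ τ : ℍ, f τ = g (Complex.exp (2 * Real.pi * Complex.I * (τ : ℂ)))) (i : ℕ) :
    iteratedDeriv i g 0 = (Nat.factorial i : ℂ) * (qExpansion 1 f).coeff i := by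
  rw [(eventually_eq f g hg h).iteratedDeriv_eq, qExpansion_coeff,
    mul_inv_cancel_left₀ (by exact_mod_cast Nat.factorial_ne_zero i)]

end
end Gam7

end PartG

/-- For every `k ≥ 0`, the `ℂ`-linear map sending a holomorphic modular form
`f ∈ M_k(Γ₁(7);ℂ)` to the first `2k+1` Taylor coefficients at `0` of the holomorphic
function `g` on the open unit disc with `f(τ) = g(e^{2πiτ})` is an isomorphism onto
`ℂ^{2k+1}`: every `f` admits such a `g`; a modular form whose `q`-expansion vanishes
modulo `q^{2k+1}` is zero; every tuple of `2k+1` coefficients is attained; and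
`dim_ℂ M_k(Γ₁(7);ℂ) = 2k+1`. -/
theorem qexpansion_truncation_iso (k : ℕ) :
    (∀ f : ModularForm (CongruenceSubgroup.Gamma1 7) (k : ℤ),
      ∃ g : ℂ → ℂ, DifferentiableOn ℂ g (Metric.ball (0 : ℂ) 1) ∧
        ∀ τ : UpperHalfPlane,
          f τ = g (Complex.exp (2 * Real.pi * Complex.I * (τ : ℂ)))) ∧
    (∀ f : ModularForm (CongruenceSubgroup.Gamma1 7) (k : ℤ), ∀ g : ℂ → ℂ,
      DifferentiableOn ℂ g (Metric.ball (0 : ℂ) 1) →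
      (∀ τ : UpperHalfPlane,
        f τ = g (Complex.exp (2 * Real.pi * Complex.I * (τ : ℂ)))) →
      (∀ i : ℕ, i < 2 * k + 1 → iteratedDeriv i g 0 = 0) → f = 0) ∧
    (∀ c : Fin (2 * k + 1) → ℂ,
      ∃ (f : ModularForm (CongruenceSubgroup.Gamma1 7) (k : ℤ)) (g : ℂ → ℂ),
        DifferentiableOn ℂ g (Metric.ball (0 : ℂ) 1) ∧
        (∀ τ : UpperHalfPlane,
          f τ = g (Complex.exp (2 * Real.pi * Complex.I * (τ : ℂ)))) ∧
        ∀ i : Fin (2 * k + 1),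
          iteratedDeriv (i : ℕ) g 0 = (Nat.factorial (i : ℕ) : ℂ) * c i) ∧
    Module.finrank ℂ (ModularForm (CongruenceSubgroup.Gamma1 7) (k : ℤ)) = 2 * k + 1 := by
  refine ⟨fun f ↦ ⟨_, Gam7.cusp_diff f, Gam7.cusp_eq f⟩, ?_, ?_, ?_⟩
  · intro f g hg h hi
    refine Gam7.sturm f fun i hik ↦ ?_
    have := Gam7.iter_eq f g hg h i
    rw [hi i hik] at this
    have hne : (Nat.factorial i : ℂ) ≠ 0 := by exact_mod_cast Nat.factorial_ne_zero i
    exact (mul_eq_zero.mp this.symm).resolve_left hne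
  · intro c
    obtain ⟨f, hf⟩ := Gam7.Tk_surjective k c
    refine ⟨f, _, Gam7.cusp_diff f, Gam7.cusp_eq f, fun i ↦ ?_⟩
    rw [Gam7.iter_eq f _ (Gam7.cusp_diff f) (Gam7.cusp_eq f) i, ← hf]
    rfl
  · have e := (LinearEquiv.ofBijective (Gam7.Tk k)
      ⟨Gam7.Tk_injective k, Gam7.Tk_surjective k⟩).finrank_eq
    rw [Module.finrank_fin_fun] at e
    exact e
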